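/- arXiv:2306.15239 — 4 statements merged into one kernel-verified Lean document; each statement's English description precedes it below -/
import Mathlib

section
/- Let d, N ∈ ℕ, 0 < p ≤ u < ∞, 0 < q < ∞, 0 < v < ∞ and let s ∈ ℝ satisfy s > d · max{0, 1/p − 1/v, 1/q − 1/v}. Then there exists a constant c > 0, independent of f, such that for every locally max{1,p,v}-integrable f : ℝ^d → ℂ: ‖(∫_1^∞ [t^{−s} · osc_v^{N−1} f(·,t)]^q dt/t)^{1/q} | M^u_p(ℝ^d)‖ ≤ c · ‖(∫_{B(·,1)} |f(y)|^v dy)^{1/v} | M^u_p(ℝ^d)‖. -/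
open MeasureTheory ENNReal Set Metric Filter
open scoped NNReal Topology

noncomputable section

abbrev Euc (d : ℕ) : Type := EuclideanSpace ℝ (Fin d)

/-- Morrey quasi-norm of an `ℝ≥0∞`-valued function on a set `Ω ⊆ ℝ^d`. -/
noncomputable def morreyNormE (d : ℕ) (p u : ℝ) (Ω : Set (Euc d)) (g : Euc d → ℝ≥0∞) : ℝ≥0∞ :=
  ⨆ (y : Euc d) (_ : y ∈ Ω) (r : ℝ) (_ : 0 < r),
    ENNReal.ofReal (r ^ ((d : ℝ) * (1 / u - 1 / p))) *
      (∫⁻ x in Ω ∩ Metric.ball y r, g x ^ p) ^ (1 / p)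

/-- Morrey quasi-norm of a complex-valued function on `Ω ⊆ ℝ^d`. -/
noncomputable def morreyNorm (d : ℕ) (p u : ℝ) (Ω : Set (Euc d)) (f : Euc d → ℂ) : ℝ≥0∞ :=
  morreyNormE d p u Ω fun x => (‖f x‖₊ : ℝ≥0∞)

/-- The set of (functions induced by) complex polynomials in `d` variables of
total degree at most `N - 1`, i.e. of total degree `< N`. -/
def polyFuns (d N : ℕ) : Set (Euc d → ℂ) :=
  {P | ∃ Q : MvPolynomial (Fin d) ℂ, Q.totalDegree < N ∧
        ∀ x : Euc d, P x = MvPolynomial.eval (fun i => ((x i : ℝ) : ℂ)) Q}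

/-- Local oscillation `osc_{v,Ω}^{N-1} f (x, t)`. -/
noncomputable def osc (d N : ℕ) (v : ℝ) (Ω : Set (Euc d)) (f : Euc d → ℂ)
    (x : Euc d) (t : ℝ) : ℝ≥0∞ :=
  ⨅ (P : Euc d → ℂ) (_ : P ∈ polyFuns d N),
    (ENNReal.ofReal (t ^ (-(d : ℝ))) *
      ∫⁻ y in Metric.ball x t ∩ Ω, (‖f y - P y‖₊ : ℝ≥0∞) ^ v) ^ (1 / v)

/-- `f` is locally `v`-integrable on `Ω`. -/
def MemLvLoc (d : ℕ) (v : ℝ) (Ω : Set (Euc d)) (f : Euc d → ℂ) : Prop :=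
  AEMeasurable f (volume.restrict Ω) ∧
    ∀ K : Set (Euc d), IsCompact K → K ⊆ Ω → (∫⁻ y in K, (‖f y‖₊ : ℝ≥0∞) ^ v) < ⊤

/-- The `N`-th order difference `Δ_h^N f (x)`. -/
noncomputable def deltaN (d N : ℕ) (f : Euc d → ℂ) (h x : Euc d) : ℂ :=
  ∑ k ∈ Finset.range (N + 1), (-1 : ℂ) ^ (N - k) * (N.choose k : ℂ) * f (x + (k : ℝ) • h)

/-- The set `V^N(x,t)` of admissible difference steps. -/
def VN (d N : ℕ) (Ω : Set (Euc d)) (x : Euc d) (t : ℝ) : Set (Euc d) :=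
  {h | ‖h‖ < t ∧ ∀ ℓ : ℕ, ℓ ≤ N → x + (ℓ : ℝ) • h ∈ Ω}

/-- The Hardy–Littlewood maximal function. -/
noncomputable def hlMaximal (d : ℕ) (f : Euc d → ℂ) (x : Euc d) : ℝ≥0∞ :=
  ⨆ (r : ℝ) (_ : 0 < r),
    (volume (Metric.ball x r))⁻¹ * ∫⁻ y in Metric.ball x r, (‖f y‖₊ : ℝ≥0∞)

/-- The inner product `⟨f,g⟩_{x,t} = t^{-d} ∫_{B(x,t) ∩ Ω} f(z) conj(g(z)) dz`. -/
noncomputable def innerXT (d : ℕ) (Ω : Set (Euc d)) (x : Euc d) (t : ℝ)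
    (f g : Euc d → ℂ) : ℂ :=
  ((t ^ (-(d : ℝ)) : ℝ) : ℂ) * ∫ z in Metric.ball x t ∩ Ω, f z * (starRingEnd ℂ) (g z)

theorem measurable_setLIntegral_ball {d : ℕ} {φ : Euc d → ℝ≥0∞} (hφ : Measurable φ) (r : ℝ) :
    Measurable fun x => ∫⁻ y in ball x r, φ y := by
  have h : (fun x => ∫⁻ y in ball x r, φ y) = fun x => ∫⁻ y,
      ({z : Euc d × Euc d | dist z.2 z.1 < r}.indicator (fun z => φ z.2)) (x, y) := by
    funext x
    rw [← lintegral_indicator measurableSet_ball]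
    rfl
  rw [h]
  refine Measurable.lintegral_prod_right' ?_
  exact (hφ.comp measurable_snd).indicator
    (measurableSet_lt (measurable_snd.dist measurable_fst) measurable_const)

theorem setLIntegral_ball_eq_translate {d : ℕ} {φ : Euc d → ℝ≥0∞} (hφ : Measurable φ)
    (x y : Euc d) (r : ℝ) :
    ∫⁻ z in ball (x + y) r, φ z = ∫⁻ h in ball y r, φ (x + h) := by
  have h := (measurePreserving_add_left (volume : Measure (Euc d)) x).setLIntegral_comp_preimage
    (measurableSet_ball (x := x + y) (ε := r)) hφ
  rw [← h]
  congr 2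
  ext z
  simp [dist_eq_norm]

theorem setLIntegral_setLIntegral_ball {d : ℕ} {φ : Euc d → ℝ≥0∞} (hφ : Measurable φ)
    (s : Set (Euc d)) (r : ℝ) :
    ∫⁻ x in s, ∫⁻ z in ball x r, φ z = ∫⁻ h in ball 0 r, ∫⁻ x in s, φ (x + h) := by
  have h : ∀ x : Euc d, ∫⁻ z in ball x r, φ z = ∫⁻ h in ball 0 r, φ (x + h) := fun x => by
    simpa using setLIntegral_ball_eq_translate hφ x 0 r
  simp_rw [h]
  exact lintegral_lintegral_swap (hφ.comp measurable_add).aemeasurable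

theorem setLIntegral_setLIntegral_ball_le {d : ℕ} {φ : Euc d → ℝ≥0∞} (hφ : Measurable φ)
    {M : ℝ≥0∞} {r : ℝ} (hM : ∀ y, ∫⁻ x in ball y r, φ x ≤ M) (y : Euc d) (R : ℝ) :
    ∫⁻ x in ball y r, ∫⁻ z in ball x R, φ z ≤ volume (ball (0 : Euc d) R) * M := by
  rw [setLIntegral_setLIntegral_ball hφ]
  calc ∫⁻ h in ball 0 R, ∫⁻ x in ball y r, φ (x + h) ≤ ∫⁻ _ in ball (0 : Euc d) R, M := by
        refine lintegral_mono fun h => ?_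
        refine le_trans (le_of_eq ?_) (hM (h + y))
        rw [setLIntegral_ball_eq_translate hφ]
        simp_rw [add_comm h]
    _ = volume (ball (0 : Euc d) R) * M := by
        rw [setLIntegral_const, mul_comm]

theorem lintegral_setLIntegral_ball {d : ℕ} {φ : Euc d → ℝ≥0∞} (hφ : Measurable φ) (r : ℝ) :
    ∫⁻ x, ∫⁻ z in ball x r, φ z = volume (ball (0 : Euc d) r) * ∫⁻ x, φ x := by
  rw [← setLIntegral_univ, setLIntegral_setLIntegral_ball hφ]
  simp_rw [Measure.restrict_univ, lintegral_add_right_eq_self φ]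
  rw [setLIntegral_const, mul_comm]

theorem volume_ball_one_mul_setLIntegral_ball_eq {d : ℕ} {φ : Euc d → ℝ≥0∞} (hφ : Measurable φ)
    (x : Euc d) {t : ℝ} (ht : 1 ≤ t) :
    volume (ball (0 : Euc d) 1) * ∫⁻ y in ball x t, φ y =
      ∫⁻ z in ball x (2 * t), ∫⁻ y in ball z 1, (ball x t).indicator φ y := by
  rw [← lintegral_indicator measurableSet_ball,
    ← lintegral_setLIntegral_ball (hφ.indicator measurableSet_ball)]
  symm
  apply setLIntegral_eq_of_support_subset
  intro z hz
  by_contra hzt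
  refine hz ?_
  change ∫⁻ y in ball z 1, (ball x t).indicator φ y = 0
  rw [setLIntegral_congr_fun (g := fun _ => 0) measurableSet_ball, lintegral_zero]
  intro y hy
  refine indicator_of_notMem (fun hyx => hzt ?_) _
  rw [mem_ball] at *
  linarith [dist_triangle_left z x y]

theorem lintegral_le_rpow_mul_lintegral_rpow {α : Type*} [MeasurableSpace α] {μ : Measure α}
    {g : α → ℝ≥0∞} {S : ℝ≥0∞} (hS : S ≠ ⊤) (hg : ∀ x, g x ≤ S) {a : ℝ} (ha : 0 < a) (ha1 : a ≤ 1) :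
    ∫⁻ x, g x ∂μ ≤ S ^ (1 - a) * ∫⁻ x, g x ^ a ∂μ := by
  rw [← lintegral_const_mul' _ _ (rpow_ne_top_of_nonneg (by linarith) hS)]
  refine lintegral_mono fun x => ?_
  calc g x = g x ^ (1 - a) * g x ^ a := by
        rw [← rpow_add_of_nonneg _ _ (by linarith) ha.le]; simp
    _ ≤ S ^ (1 - a) * g x ^ a := by
        exact mul_le_mul_left (rpow_le_rpow (hg x) (by linarith)) _

theorem lintegral_rpow_le_measure_rpow_mul {α : Type*} [MeasurableSpace α] {μ : Measure α}
    {g : α → ℝ≥0∞} (hg : AEMeasurable g μ) {a : ℝ} (ha : 1 < a) :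
    (∫⁻ x, g x ∂μ) ^ a ≤ μ univ ^ (a - 1) * ∫⁻ x, g x ^ a ∂μ := by
  have ha0 : 0 < a := by linarith
  have hc := Real.HolderConjugate.conjExponent ha
  have h := lintegral_mul_le_Lp_mul_Lq μ hc hg (aemeasurable_const (b := (1 : ℝ≥0∞)))
  simp only [Pi.mul_apply, mul_one, one_rpow, lintegral_const, one_mul] at h
  calc (∫⁻ x, g x ∂μ) ^ a
      ≤ ((∫⁻ x, g x ^ a ∂μ) ^ (1 / a) * μ univ ^ (1 / a.conjExponent)) ^ a := by gcongr
    _ = μ univ ^ (a - 1) * ∫⁻ x, g x ^ a ∂μ := by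
        rw [mul_rpow_of_nonneg _ _ ha0.le, ← rpow_mul, ← rpow_mul, one_div_mul_cancel ha0.ne',
          rpow_one, mul_comm]
        congr 2
        rw [Real.conjExponent]
        have : a - 1 ≠ 0 := by linarith
        field_simp

theorem volume_ball_eq_rpow (d : ℕ) (x : Euc d) {t : ℝ} (ht : 0 < t) :
    volume (ball x t) = ENNReal.ofReal t ^ (d : ℝ) * volume (ball (0 : Euc d) 1) := by
  rw [Measure.addHaar_ball_of_pos volume x ht, finrank_euclideanSpace_fin, rpow_natCast, ofReal_pow ht.le]

/-- Large-ball integrals are controlled by integrals of powers of unit-ball integrals. -/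
theorem exists_setLIntegral_ball_rpow_le (d : ℕ) {a : ℝ} (ha : 0 < a) :
    ∃ C : ℝ≥0∞, C ≠ ⊤ ∧ ∀ φ : Euc d → ℝ≥0∞, Measurable φ → ∀ (x : Euc d) (t : ℝ), 1 ≤ t →
      ∫⁻ y in ball x t, φ y ≠ ⊤ →
      (∫⁻ y in ball x t, φ y) ^ a ≤ C * ENNReal.ofReal t ^ ((d : ℝ) * (max a 1 - 1)) *
        ∫⁻ z in ball x (2 * t), (∫⁻ y in ball z 1, φ y) ^ a := by
  set κ := volume (ball (0 : Euc d) 1) with hκ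
  have hκ0 : κ ≠ 0 := (measure_ball_pos _ _ one_pos).ne'
  have hκT : κ ≠ ⊤ := measure_ball_lt_top.ne
  rcases le_or_gt a 1 with ha1 | ha1
  · refine ⟨κ⁻¹, by simpa using hκ0, fun φ hφ x t ht hS => ?_⟩
    rw [max_eq_right ha1]
    simp only [sub_self, mul_zero, rpow_zero, mul_one]
    rw [← ENNReal.mul_le_iff_le_inv hκ0 hκT]
    set S := ∫⁻ y in ball x t, φ y with hSdef
    rcases eq_or_ne S 0 with h0 | h0
    · simp [h0, ha]
    have hind : ∀ z, ∫⁻ y in ball z 1, (ball x t).indicator φ y ≤ S := fun z => by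
      rw [hSdef, ← lintegral_indicator (measurableSet_ball (x := x) (ε := t))]
      exact setLIntegral_le_lintegral _ _
    have h1 := lintegral_le_rpow_mul_lintegral_rpow (μ := volume.restrict (ball x (2 * t)))
      hS hind ha ha1
    rw [← volume_ball_one_mul_setLIntegral_ball_eq hφ x ht] at h1
    have hP0 : S ^ (1 - a) ≠ 0 := (rpow_pos (pos_iff_ne_zero.2 h0) hS).ne'
    have hPT : S ^ (1 - a) ≠ ⊤ := rpow_ne_top_of_nonneg (by linarith) hS
    rw [← ENNReal.mul_le_mul_iff_right hP0 hPT]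
    calc S ^ (1 - a) * (κ * S ^ a) = κ * S := by
          rw [mul_left_comm, ← rpow_add_of_nonneg _ _ (by linarith) ha.le]; simp
      _ ≤ _ := h1
      _ ≤ _ := by
          gcongr
          exact indicator_le_self _ _ _
  · refine ⟨κ⁻¹ ^ a * (ENNReal.ofReal 2 ^ (d : ℝ) * κ) ^ (a - 1), ?_, fun φ hφ x t ht hS => ?_⟩
    · refine mul_ne_top (rpow_ne_top_of_nonneg ha.le (by simpa using hκ0))
        (rpow_ne_top_of_nonneg (by linarith)
          (mul_ne_top (rpow_ne_top_of_nonneg (by positivity) ofReal_ne_top) hκT))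
    have ht0 : 0 < t := by linarith
    rw [max_eq_left ha1.le]
    have h1 := lintegral_rpow_le_measure_rpow_mul (μ := volume.restrict (ball x (2 * t)))
      (measurable_setLIntegral_ball hφ 1).aemeasurable ha1
    have h2 : κ * ∫⁻ y in ball x t, φ y ≤ ∫⁻ z in ball x (2 * t), ∫⁻ y in ball z 1, φ y := by
      rw [volume_ball_one_mul_setLIntegral_ball_eq hφ x ht]
      gcongr
      exact indicator_le_self _ _ _
    rw [Measure.restrict_apply_univ, volume_ball_eq_rpow d x (by linarith : 0 < 2 * t),
      ofReal_mul zero_le_two] at h1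
    calc (∫⁻ y in ball x t, φ y) ^ a = κ⁻¹ ^ a * (κ * ∫⁻ y in ball x t, φ y) ^ a := by
          rw [← mul_rpow_of_nonneg _ _ ha.le, ← mul_assoc, ENNReal.inv_mul_cancel hκ0 hκT, one_mul]
      _ ≤ κ⁻¹ ^ a * ((ENNReal.ofReal 2 * ENNReal.ofReal t) ^ (d : ℝ) * κ) ^ (a - 1) *
          ∫⁻ z in ball x (2 * t), (∫⁻ y in ball z 1, φ y) ^ a := by
          rw [mul_assoc]
          gcongr
          exact le_trans (by gcongr) h1
      _ = _ := by
          have hd0 : (0 : ℝ) ≤ d := by positivity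
          rw [mul_rpow_of_nonneg _ _ hd0, mul_right_comm (ENNReal.ofReal 2 ^ (d : ℝ)),
            mul_rpow_of_nonneg _ (ENNReal.ofReal t ^ (d : ℝ)) (by linarith : 0 ≤ a - 1), ← rpow_mul]
          ring

theorem tsum_ofReal_two_pow_rpow_ne_top {α : ℝ} (hα : α < 0) :
    ∑' j : ℕ, ENNReal.ofReal (2 ^ j) ^ α ≠ ⊤ := by
  have h : ∀ j : ℕ, ENNReal.ofReal (2 ^ j) ^ α = (2 ^ α) ^ j := fun j => by
    rw [ofReal_pow zero_le_two, ← rpow_natCast, ← rpow_natCast, ← rpow_mul, ← rpow_mul, mul_comm]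
    simp
  simp_rw [h]
  rw [ENNReal.tsum_geometric]
  have : (2 : ℝ≥0∞) ^ α < 1 := rpow_lt_one_of_one_lt_of_neg (by norm_num) hα
  simpa [tsub_eq_zero_iff_le] using this

theorem setLIntegral_Ioi_ofReal_rpow_ne_top {γ : ℝ} (hγ : γ < -1) :
    ∫⁻ t in Ioi (1 : ℝ), ENNReal.ofReal t ^ γ ≠ ⊤ := by
  have h := (integrableOn_Ioi_rpow_of_lt hγ one_pos).lintegral_lt_top
  refine ne_of_eq_of_ne (setLIntegral_congr_fun measurableSet_Ioi fun t ht => ?_) h.ne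
  exact ofReal_rpow_of_pos (one_pos.trans ht)

/-- A monotone function is bounded by `t ^ β` times its dyadic weighted sum. -/
theorem le_rpow_mul_tsum_dyadic {F : ℝ → ℝ≥0∞} (hF : Monotone F) {β : ℝ} (hβ : 0 ≤ β) {t : ℝ}
    (ht : 1 ≤ t) :
    F t ≤ ENNReal.ofReal (2 * t) ^ β *
      ∑' j : ℕ, ENNReal.ofReal (2 ^ j) ^ (-β) * F (2 ^ j) := by
  obtain ⟨n, hn1, hn2⟩ := exists_nat_pow_near ht one_lt_two
  have h0 : ENNReal.ofReal (2 ^ (n + 1)) ≠ 0 := by simp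
  calc F t ≤ F (2 ^ (n + 1)) := hF hn2.le
    _ = ENNReal.ofReal (2 ^ (n + 1)) ^ β *
        (ENNReal.ofReal (2 ^ (n + 1)) ^ (-β) * F (2 ^ (n + 1))) := by
        rw [← mul_assoc, ← rpow_add _ _ h0 ofReal_ne_top]; simp
    _ ≤ _ := by
        gcongr
        · rw [pow_succ']; gcongr
        · exact ENNReal.le_tsum (f := fun j : ℕ => ENNReal.ofReal (2 ^ j) ^ (-β) * F (2 ^ j)) (n + 1)

theorem osc_le_rpow_mul (d : ℕ) {N : ℕ} (hN : 0 < N) {v : ℝ} (hv : 0 < v) (f : Euc d → ℂ)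
    (x : Euc d) {t : ℝ} (ht : 0 < t) :
    osc d N v univ f x t ≤ ENNReal.ofReal t ^ (-(d : ℝ) / v) *
      (∫⁻ y in ball x t, (‖f y‖₊ : ℝ≥0∞) ^ v) ^ (1 / v) := by
  refine (iInf₂_le (fun _ => 0) ⟨0, by simpa using hN, by simp⟩).trans (le_of_eq ?_)
  rw [mul_rpow_of_nonneg _ _ (by positivity), ← ofReal_rpow_of_pos ht, ← rpow_mul]
  simp [div_eq_mul_inv]

theorem lintegral_rpow_nnnorm_lt_top_of_memLvLoc {d : ℕ} {v m : ℝ} (hv : 0 ≤ v) (hvm : v ≤ m)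
    {f : Euc d → ℂ} (hf : MemLvLoc d m univ f) (x : Euc d) (t : ℝ) :
    ∫⁻ y in ball x t, (‖f y‖₊ : ℝ≥0∞) ^ v < ⊤ := by
  have h := hf.2 (closedBall x t) (isCompact_closedBall x t) (subset_univ _)
  calc ∫⁻ y in ball x t, (‖f y‖₊ : ℝ≥0∞) ^ v
      ≤ ∫⁻ y in closedBall x t, (1 + (‖f y‖₊ : ℝ≥0∞) ^ m) := by
        refine (lintegral_mono_set ball_subset_closedBall).trans (lintegral_mono fun y => ?_)
        rcases le_total (‖f y‖₊ : ℝ≥0∞) 1 with h1 | h1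
        · exact (rpow_le_one h1 hv).trans le_self_add
        · exact (rpow_le_rpow_of_exponent_le h1 hvm).trans le_add_self
    _ < ⊤ := by
        rw [lintegral_add_left measurable_const, setLIntegral_const, one_mul]
        exact add_lt_top.2 ⟨measure_closedBall_lt_top, h⟩

/-- Pointwise control of the large-scale oscillation functional by a dyadic sum. -/
theorem exists_oscillation_functional_rpow_le (d : ℕ) {N : ℕ} (hN : 0 < N) {p q v s β : ℝ}
    (hp : 0 < p) (hq : 0 < q) (hv : 0 < v) (hβ0 : 0 ≤ β) (hβ : β < p * s + d * (p / v)) :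
    ∃ C : ℝ≥0∞, C ≠ ⊤ ∧ ∀ (f : Euc d → ℂ) (x : Euc d),
      ((∫⁻ t in Ioi (1 : ℝ), (ENNReal.ofReal (t ^ (-s)) * osc d N v univ f x t) ^ q
        * ENNReal.ofReal (1 / t)) ^ (1 / q)) ^ p ≤
      C * ∑' j : ℕ, ENNReal.ofReal (2 ^ j) ^ (-β) *
        (∫⁻ y in ball x (2 ^ j), (‖f y‖₊ : ℝ≥0∞) ^ v) ^ (p / v) := by
  set γ : ℝ := (-s + -(d : ℝ) / v + β / p) * q - 1 with hγdef
  have hγ : γ < -1 := by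
    have : -s + -(d : ℝ) / v + β / p < 0 := by
      have h : β / p < s + d / v := by
        rw [div_lt_iff₀ hp]; exact hβ.trans_eq (by ring)
      rw [neg_div]; linarith
    have := mul_neg_of_neg_of_pos this hq
    linarith
  set I : ℝ≥0∞ := ENNReal.ofReal 2 ^ (β / p * q) * ∫⁻ t in Ioi (1 : ℝ), ENNReal.ofReal t ^ γ with hI
  have hIT : I ≠ ⊤ := mul_ne_top (rpow_ne_top_of_nonneg (by positivity) ofReal_ne_top)
    (setLIntegral_Ioi_ofReal_rpow_ne_top hγ)
  refine ⟨I ^ (p / q), rpow_ne_top_of_nonneg (by positivity) hIT, fun f x => ?_⟩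
  set E : ℝ≥0∞ := ∑' j : ℕ, ENNReal.ofReal (2 ^ j) ^ (-β) *
    (∫⁻ y in ball x (2 ^ j), (‖f y‖₊ : ℝ≥0∞) ^ v) ^ (p / v) with hE
  have hmono : Monotone fun t : ℝ => (∫⁻ y in ball x t, (‖f y‖₊ : ℝ≥0∞) ^ v) ^ (p / v) :=
    fun t₁ t₂ h => by dsimp only; gcongr
  have hpt : ∀ t ∈ Ioi (1 : ℝ), (ENNReal.ofReal (t ^ (-s)) * osc d N v univ f x t) ^ q
      * ENNReal.ofReal (1 / t) ≤
      (ENNReal.ofReal 2 ^ (β / p * q) * ENNReal.ofReal t ^ γ) * E ^ (q / p) := by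
    intro t ht
    have ht0 : 0 < t := one_pos.trans ht
    have hτ0 : ENNReal.ofReal t ≠ 0 := by simpa using ht0
    have hS : (∫⁻ y in ball x t, (‖f y‖₊ : ℝ≥0∞) ^ v) ^ (1 / v) ≤
        ENNReal.ofReal 2 ^ (β / p) * ENNReal.ofReal t ^ (β / p) * E ^ (1 / p) := by
      have h := rpow_le_rpow (le_rpow_mul_tsum_dyadic hmono hβ0 (le_of_lt ht))
        (by positivity : 0 ≤ 1 / p)
      rw [← rpow_mul, ← hE, mul_rpow_of_nonneg _ _ (by positivity), ← rpow_mul,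
        ofReal_mul zero_le_two, mul_rpow_of_nonneg _ _ (by positivity)] at h
      convert h using 2
      · field_simp
      · rw [mul_one_div]
    calc (ENNReal.ofReal (t ^ (-s)) * osc d N v univ f x t) ^ q * ENNReal.ofReal (1 / t)
        ≤ (ENNReal.ofReal t ^ (-s) * (ENNReal.ofReal t ^ (-(d : ℝ) / v) *
          (ENNReal.ofReal 2 ^ (β / p) * ENNReal.ofReal t ^ (β / p) * E ^ (1 / p)))) ^ q *
          ENNReal.ofReal t ^ (-1 : ℝ) := by
          have h1 : ENNReal.ofReal (1 / t) = ENNReal.ofReal t ^ (-1 : ℝ) := by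
            rw [rpow_neg_one, one_div, ofReal_inv_of_pos ht0]
          rw [h1, ← ofReal_rpow_of_pos ht0]
          gcongr
          exact (osc_le_rpow_mul d hN hv f x ht0).trans (by gcongr)
      _ = (ENNReal.ofReal 2 ^ (β / p) * ENNReal.ofReal t ^ (-s + -(d : ℝ) / v + β / p) *
          E ^ (1 / p)) ^ q * ENNReal.ofReal t ^ (-1 : ℝ) := by
          rw [rpow_add _ _ hτ0 ofReal_ne_top, rpow_add _ _ hτ0 ofReal_ne_top]
          congr 2
          ring
      _ = _ := by
          rw [mul_rpow_of_nonneg _ _ hq.le, mul_rpow_of_nonneg _ _ hq.le, ← rpow_mul, ← rpow_mul,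
            ← rpow_mul, hγdef, sub_eq_add_neg, rpow_add _ _ hτ0 ofReal_ne_top, one_div_mul_eq_div]
          ring
  calc ((∫⁻ t in Ioi (1 : ℝ), (ENNReal.ofReal (t ^ (-s)) * osc d N v univ f x t) ^ q
        * ENNReal.ofReal (1 / t)) ^ (1 / q)) ^ p
      ≤ ((∫⁻ t in Ioi (1 : ℝ), (ENNReal.ofReal 2 ^ (β / p * q) * ENNReal.ofReal t ^ γ) *
        E ^ (q / p)) ^ (1 / q)) ^ p := by
        gcongr ((?_) ^ (1 / q)) ^ p
        exact setLIntegral_mono' measurableSet_Ioi hpt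
    _ = ((I * E ^ (q / p)) ^ (1 / q)) ^ p := by
        rw [lintegral_mul_const _ (by fun_prop), lintegral_const_mul _ (by fun_prop)]
    _ = I ^ (p / q) * E := by
        rw [← rpow_mul, one_div_mul_eq_div, mul_rpow_of_nonneg _ _ (by positivity), ← rpow_mul]
        have : q / p * (p / q) = 1 := by field_simp
        rw [this, rpow_one]

/-- Integration of the dyadic sum over balls. -/
theorem exists_setLIntegral_tsum_dyadic_le (d : ℕ) {a β : ℝ} (ha : 0 < a)
    (hβ : (d : ℝ) * max a 1 < β) :
    ∃ C : ℝ≥0∞, C ≠ ⊤ ∧ ∀ φ : Euc d → ℝ≥0∞, Measurable φ →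
      (∀ x t, ∫⁻ y in ball x t, φ y ≠ ⊤) → ∀ (M : ℝ≥0∞) (r : ℝ),
      (∀ y, ∫⁻ x in ball y r, (∫⁻ z in ball x 1, φ z) ^ a ≤ M) → ∀ y,
      ∫⁻ x in ball y r, ∑' j : ℕ, ENNReal.ofReal (2 ^ j) ^ (-β) *
        (∫⁻ z in ball x (2 ^ j), φ z) ^ a ≤ C * M := by
  obtain ⟨C, hC, h⟩ := exists_setLIntegral_ball_rpow_le d ha
  set κ := volume (ball (0 : Euc d) 1) with hκ
  have hκT : κ ≠ ⊤ := measure_ball_lt_top.ne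
  refine ⟨(∑' j : ℕ, ENNReal.ofReal (2 ^ j) ^ ((d : ℝ) * max a 1 - β)) *
    (C * (ENNReal.ofReal 2 ^ (d : ℝ) * κ)), ?_, fun φ hφ hfin M r hM y => ?_⟩
  · exact mul_ne_top (tsum_ofReal_two_pow_rpow_ne_top (by linarith)) (mul_ne_top hC
      (mul_ne_top (rpow_ne_top_of_nonneg (by positivity) ofReal_ne_top) hκT))
  have hmeas : ∀ R, Measurable fun x => (∫⁻ z in ball x R, φ z) ^ a := fun R =>
    (measurable_setLIntegral_ball hφ R).pow_const a
  rw [lintegral_tsum fun j => ((hmeas _).const_mul _).aemeasurable, mul_assoc, ← ENNReal.tsum_mul_right]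
  refine ENNReal.tsum_le_tsum fun j => ?_
  have hj1 : (1 : ℝ) ≤ 2 ^ j := one_le_pow₀ one_le_two
  have hj0 : ENNReal.ofReal (2 ^ j) ≠ 0 := by simp
  set τ := ENNReal.ofReal (2 ^ j) with hτ
  have hτT : τ ≠ ⊤ := ofReal_ne_top
  calc ∫⁻ x in ball y r, τ ^ (-β) * (∫⁻ z in ball x (2 ^ j), φ z) ^ a
      ≤ ∫⁻ x in ball y r, τ ^ (-β) * (C * τ ^ ((d : ℝ) * (max a 1 - 1)) *
        ∫⁻ w in ball x (2 * 2 ^ j), (∫⁻ z in ball w 1, φ z) ^ a) := by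
        gcongr with x
        exact h φ hφ x _ hj1 (hfin _ _)
    _ = τ ^ (-β) * (C * τ ^ ((d : ℝ) * (max a 1 - 1))) *
        ∫⁻ x in ball y r, ∫⁻ w in ball x (2 * 2 ^ j), (∫⁻ z in ball w 1, φ z) ^ a := by
        simp_rw [← mul_assoc]
        rw [lintegral_const_mul _ (measurable_setLIntegral_ball (hmeas 1) _)]
    _ ≤ τ ^ (-β) * (C * τ ^ ((d : ℝ) * (max a 1 - 1))) *
        (volume (ball (0 : Euc d) (2 * 2 ^ j)) * M) := by
        gcongr
        exact setLIntegral_setLIntegral_ball_le (hmeas 1) hM y _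
    _ = τ ^ ((d : ℝ) * max a 1 - β) * (C * (ENNReal.ofReal 2 ^ (d : ℝ) * κ) * M) := by
        have he : (d : ℝ) * max a 1 - β = -β + (d : ℝ) * (max a 1 - 1) + d := by ring
        rw [volume_ball_eq_rpow d 0 (by positivity), ofReal_mul zero_le_two,
          mul_rpow_of_nonneg _ _ (by positivity), he, rpow_add _ _ hj0 hτT, rpow_add _ _ hj0 hτT]
        ring

theorem morreyNormE_le_of_setLIntegral_le {d : ℕ} {p u : ℝ} (hp : 0 < p) {C : ℝ≥0∞}
    {g G : Euc d → ℝ≥0∞}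
    (h : ∀ (M : ℝ≥0∞) (r : ℝ), (∀ y, ∫⁻ x in ball y r, g x ^ p ≤ M) →
      ∀ y, ∫⁻ x in ball y r, G x ^ p ≤ C * M) :
    morreyNormE d p u univ G ≤ C ^ (1 / p) * morreyNormE d p u univ g := by
  set K := morreyNormE d p u univ g with hK
  refine iSup₂_le fun y _ => iSup₂_le fun r hr => ?_
  set ρ := ENNReal.ofReal (r ^ ((d : ℝ) * (1 / u - 1 / p))) with hρ
  have hρ0 : ρ ≠ 0 := by simpa [hρ] using Real.rpow_pos_of_pos hr _
  have hρT : ρ ≠ ⊤ := ofReal_ne_top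
  have hg : ∀ y, ∫⁻ x in ball y r, g x ^ p ≤ (ρ⁻¹ * K) ^ p := fun y => by
    have h1 : ρ * (∫⁻ x in univ ∩ ball y r, g x ^ p) ^ (1 / p) ≤ K :=
      le_iSup₂_of_le y (mem_univ y) (le_iSup₂_of_le r hr le_rfl)
    rw [univ_inter] at h1
    calc ∫⁻ x in ball y r, g x ^ p
        = (ρ⁻¹ * (ρ * (∫⁻ x in ball y r, g x ^ p) ^ (1 / p))) ^ p := by
          rw [← mul_assoc, ENNReal.inv_mul_cancel hρ0 hρT, one_mul, ← rpow_mul,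
            one_div_mul_cancel hp.ne', rpow_one]
      _ ≤ (ρ⁻¹ * K) ^ p := by gcongr
  have hG := h _ r hg y
  rw [univ_inter]
  calc ρ * (∫⁻ x in ball y r, G x ^ p) ^ (1 / p) ≤ ρ * (C * (ρ⁻¹ * K) ^ p) ^ (1 / p) := by gcongr
    _ = C ^ (1 / p) * K := by
        rw [mul_rpow_of_nonneg _ _ (by positivity), ← rpow_mul, mul_one_div_cancel hp.ne', rpow_one,
          mul_left_comm, ← mul_assoc ρ, ENNReal.mul_inv_cancel hρ0 hρT, one_mul]

/-- The large-scale part (`t ≥ 1`) of the oscillation quasi-norm is controlled in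
`M^u_p(ℝ^d)` by the local `v`-means, provided
`s > d · max{0, 1/p − 1/v, 1/q − 1/v}`. -/
theorem statement12 (d N : ℕ) (hd : 0 < d) (hN : 0 < N)
    (p u q v s : ℝ) (hp : 0 < p) (hpu : p ≤ u) (hq : 0 < q) (hv : 0 < v)
    (hs : (d : ℝ) * max 0 (max (1 / p - 1 / v) (1 / q - 1 / v)) < s) :
    ∃ c : ℝ, 0 < c ∧
      ∀ f : Euc d → ℂ, MemLvLoc d (max 1 (max p v)) Set.univ f →
        morreyNormE d p u Set.univ
            (fun x => (∫⁻ t in Set.Ioi (1 : ℝ),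
              (ENNReal.ofReal (t ^ (-s)) * osc d N v Set.univ f x t) ^ q
                * ENNReal.ofReal (1 / t)) ^ (1 / q))
          ≤ ENNReal.ofReal c *
            morreyNormE d p u Set.univ
              (fun x => (∫⁻ y in Metric.ball x 1, (‖f y‖₊ : ℝ≥0∞) ^ v) ^ (1 / v)) := by
  set a : ℝ := p / v with ha_def
  have ha : 0 < a := div_pos hp hv
  obtain ⟨β, hβ1, hβ2⟩ : ∃ β, (d : ℝ) * max a 1 < β ∧ β < p * s + d * a := by
    refine exists_between ?_
    have hd0 : (0 : ℝ) ≤ d := by positivity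
    have h1 : (d : ℝ) * max 0 (1 / p - 1 / v) < s :=
      lt_of_le_of_lt (by gcongr; exact le_max_left _ _) hs
    have h2 : max a 1 = p * max 0 (1 / p - 1 / v) + a := by
      rw [mul_max_of_nonneg _ _ hp.le, ← max_add_add_right, mul_zero, zero_add]
      congr 1
      rw [ha_def]
      field_simp
      ring
    have h3 := mul_lt_mul_of_pos_left h1 hp
    rw [h2]
    linarith
  have hβ0 : 0 ≤ β := le_trans (by positivity) hβ1.le
  obtain ⟨C₁, hC₁, h₁⟩ := exists_oscillation_functional_rpow_le d hN hp hq hv hβ0 hβ2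
  obtain ⟨C₂, hC₂, h₂⟩ := exists_setLIntegral_tsum_dyadic_le d ha hβ1
  have hCT : (C₁ * C₂) ^ (1 / p) ≠ ⊤ :=
    rpow_ne_top_of_nonneg (by positivity) (mul_ne_top hC₁ hC₂)
  refine ⟨((C₁ * C₂) ^ (1 / p)).toReal + 1, by positivity, fun f hf => ?_⟩
  have hle : (C₁ * C₂) ^ (1 / p) ≤ ENNReal.ofReal (((C₁ * C₂) ^ (1 / p)).toReal + 1) := by
    rw [ENNReal.le_ofReal_iff_toReal_le hCT (by positivity)]
    linarith
  refine le_trans (morreyNormE_le_of_setLIntegral_le hp fun M r hM y => ?_) (by gcongr)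
  have hfm : AEMeasurable f := by simpa using hf.1
  set φ : Euc d → ℝ≥0∞ := fun y => (‖hfm.mk f y‖₊ : ℝ≥0∞) ^ v with hφ_def
  have hφ : Measurable φ := (hfm.measurable_mk.nnnorm.coe_nnreal_ennreal).pow_const v
  have hfφ : ∀ x t, ∫⁻ y in ball x t, (‖f y‖₊ : ℝ≥0∞) ^ v = ∫⁻ y in ball x t, φ y := fun x t =>
    lintegral_congr_ae (ae_restrict_of_ae (hfm.ae_eq_mk.mono fun y hy => by simp [hφ_def, ← hy]))
  have hfin : ∀ x t, ∫⁻ y in ball x t, φ y ≠ ⊤ := fun x t => by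
    rw [← hfφ]
    exact (lintegral_rpow_nnnorm_lt_top_of_memLvLoc hv.le
      ((le_max_right p v).trans (le_max_right _ _)) hf x t).ne
  simp_rw [hfφ, ← rpow_mul, one_div_mul_eq_div] at hM
  calc _ ≤ ∫⁻ x in ball y r, C₁ * ∑' j : ℕ, ENNReal.ofReal (2 ^ j) ^ (-β) *
        (∫⁻ z in ball x (2 ^ j), φ z) ^ a := by
        refine lintegral_mono fun x => ?_
        simpa only [hfφ] using h₁ f x
    _ ≤ C₁ * (C₂ * M) := by
        rw [lintegral_const_mul' _ _ hC₁]
        gcongr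
        exact h₂ φ hφ hfin M r hM y
    _ = C₁ * C₂ * M := (mul_assoc _ _ _).symm
end
end

section
/- Let d, N ∈ ℕ and let Ω ⊆ ℝ^d be a nonempty open set. Then there exists a constant c > 0, depending only on d and N, such that for every measurable locally integrable f : Ω → ℂ, every polynomial P ∈ 𝒫_{N−1}, every x ∈ Ω and every t > 0: t^{−d} ∫_{V^N(x, t/N)} |Δ_h^N f(x)| dh ≤ c · ( |f(x) − P(x)| + t^{−d} ∫_{B(x,t) ∩ Ω} |f(y) − P(y)| dy ). (For h ∈ V^N(x, t/N) all points x + kh, 0 ≤ k ≤ N, lie in Ω, so Δ_h^N f(x) is well defined.) -/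
open MeasureTheory ENNReal Set Metric Filter
open scoped NNReal Topology

noncomputable section

lemma continuous_of_mem_polyFuns {d N : ℕ} {P : Euc d → ℂ} (hP : P ∈ polyFuns d N) :
    Continuous P := by
  obtain ⟨Q, -, hQ⟩ := hP
  rw [funext hQ]
  exact (MvPolynomial.continuous_eval Q).comp (by fun_prop)

/-- Restricting a polynomial of degree `< N` to a line gives a univariate polynomial of degree
`< N`, so its `N`-th order differences vanish. -/
lemma deltaN_eq_zero_of_mem_polyFuns {d N : ℕ} {P : Euc d → ℂ} (hP : P ∈ polyFuns d N)
    (h x : Euc d) : deltaN d N P h x = 0 := by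
  obtain ⟨Q, hQdeg, hQ⟩ := hP
  set q : Polynomial ℂ := MvPolynomial.aeval
    (fun i => Polynomial.C ((h i : ℝ) : ℂ) * Polynomial.X + Polynomial.C ((x i : ℝ) : ℂ)) Q with hq
  have hqdeg : q.natDegree < N :=
    (MvPolynomial.aeval_natDegree_le Q le_rfl _ fun i =>
      Polynomial.natDegree_linear_le).trans_lt (by simpa using hQdeg)
  have hqeval (k : ℕ) : q.eval (k : ℂ) = P (x + (k : ℝ) • h) := by
    rw [hQ, hq, ← Polynomial.coe_aeval_eq_eval, MvPolynomial.comp_aeval_apply,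
      MvPolynomial.aeval_eq_eval]
    congr 2
    ext i
    simp
    ring
  have hzero := congr_fun (Polynomial.fwdDiff_iter_eq_zero_of_degree_lt hqdeg) 0
  rw [fwdDiff_iter_eq_sum_shift] at hzero
  simpa [deltaN, hqeval] using hzero

lemma deltaN_sub (d N : ℕ) (f g : Euc d → ℂ) (h x : Euc d) :
    deltaN d N (fun y => f y - g y) h x = deltaN d N f h x - deltaN d N g h x := by
  simp only [deltaN, mul_sub, Finset.sum_sub_distrib]

lemma enorm_deltaN_le (d N : ℕ) (f : Euc d → ℂ) (h x : Euc d) :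
    ‖deltaN d N f h x‖ₑ ≤
      ∑ k ∈ Finset.range (N + 1), (N.choose k : ℝ≥0∞) * ‖f (x + (k : ℝ) • h)‖ₑ := by
  refine (enorm_sum_le _ _).trans (Finset.sum_le_sum fun k _ => ?_)
  have hchoose : ‖(N.choose k : ℂ)‖ₑ = N.choose k := by
    rw [← ofReal_norm, Complex.norm_natCast, ENNReal.ofReal_natCast]
  simp [enorm_mul, enorm_pow, hchoose]

/-- For a natural number `k ≠ 0`, the map `h ↦ x + k • h` does not increase volume integrals. -/
lemma lintegral_add_natCast_smul_le {d k : ℕ} (hk : k ≠ 0) (x : Euc d) {G : Euc d → ℝ≥0∞}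
    (hG : AEMeasurable G) : ∫⁻ h, G (x + (k : ℝ) • h) ≤ ∫⁻ y, G y := by
  have hk' : (k : ℝ) ≠ 0 := Nat.cast_ne_zero.2 hk
  have hmap := Measure.map_addHaar_smul (volume : Measure (Euc d)) hk'
  have hGx : AEMeasurable (fun y => G (x + y)) :=
    hG.comp_quasiMeasurePreserving (measurePreserving_add_left volume x).quasiMeasurePreserving
  have hGx' : AEMeasurable (fun y => G (x + y)) (Measure.map ((k : ℝ) • ·) volume) :=
    hGx.mono_ac (Measure.quasiMeasurePreserving_smul volume hk').absolutelyContinuous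
  calc ∫⁻ h, G (x + (k : ℝ) • h)
      = ∫⁻ y, G (x + y) ∂(Measure.map ((k : ℝ) • ·) volume) :=
        (lintegral_map' hGx' (measurable_const_smul _).aemeasurable).symm
    _ = ENNReal.ofReal |((k : ℝ) ^ Module.finrank ℝ (Euc d))⁻¹| * ∫⁻ y, G y := by
        rw [hmap, lintegral_smul_measure, lintegral_add_left_eq_self, smul_eq_mul]
    _ ≤ 1 * ∫⁻ y, G y := by
        gcongr
        rw [← ENNReal.ofReal_one, abs_of_nonneg (by positivity)]
        refine ENNReal.ofReal_le_ofReal (inv_le_one_of_one_le₀ (one_le_pow₀ ?_))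
        exact_mod_cast Nat.one_le_iff_ne_zero.2 hk
    _ = ∫⁻ y, G y := one_mul _

lemma ofReal_rpow_neg_mul_volume_ball (d : ℕ) {t : ℝ} (ht : 0 < t) :
    ENNReal.ofReal (t ^ (-(d : ℝ))) * volume (ball (0 : Euc d) t) =
      volume (ball (0 : Euc d) 1) := by
  have hball := Measure.addHaar_ball_of_pos (volume : Measure (Euc d)) 0 ht
  rw [hball, finrank_euclideanSpace_fin, ← mul_assoc, ← ENNReal.ofReal_mul (by positivity),
    Real.rpow_neg ht.le, Real.rpow_natCast, inv_mul_cancel₀ (by positivity), ENNReal.ofReal_one,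
    one_mul]

/-- Mean of `N`-th order differences over the admissible step set `V^N(x, t/N)`
is controlled by the value `|f - P|(x)` plus the local mean of `|f - P|`,
for any polynomial `P ∈ 𝒫_{N-1}`, with a constant depending only on `d`, `N`. -/
theorem statement13 (d N : ℕ) (hd : 0 < d) (hN : 0 < N) :
    ∃ c : ℝ, 0 < c ∧
      ∀ (Ω : Set (Euc d)), IsOpen Ω → Ω.Nonempty →
      ∀ f : Euc d → ℂ, MemLvLoc d 1 Ω f →
      ∀ P ∈ polyFuns d N, ∀ x ∈ Ω, ∀ t : ℝ, 0 < t →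
        ENNReal.ofReal (t ^ (-(d : ℝ))) *
            (∫⁻ h in VN d N Ω x (t / N), (‖deltaN d N f h x‖₊ : ℝ≥0∞))
          ≤ ENNReal.ofReal c *
            ((‖f x - P x‖₊ : ℝ≥0∞) +
              ENNReal.ofReal (t ^ (-(d : ℝ))) *
                ∫⁻ y in Metric.ball x t ∩ Ω, (‖f y - P y‖₊ : ℝ≥0∞)) := by
  set v : ℝ≥0∞ := volume (ball (0 : Euc d) 1)
  have hvtop : v ≠ ⊤ := measure_ball_lt_top.ne
  refine ⟨2 ^ N * (v.toReal + 1), by positivity, ?_⟩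
  intro Ω hΩ _ f hf P hP x hx t ht
  simp only [← enorm_eq_nnnorm]
  set τ : ℝ≥0∞ := ENNReal.ofReal (t ^ (-(d : ℝ)))
  set V := VN d N Ω x (t / N)
  have hN' : (0 : ℝ) < N := Nat.cast_pos.2 hN
  have hmeas : MeasurableSet (ball x t ∩ Ω) := measurableSet_ball.inter hΩ.measurableSet
  set G : Euc d → ℝ≥0∞ := (ball x t ∩ Ω).indicator fun y => ‖f y - P y‖ₑ with hG
  have hGm : AEMeasurable G := (aemeasurable_indicator_iff hmeas).2
    (((hf.1.mono_set inter_subset_right).sub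
      (continuous_of_mem_polyFuns hP).aemeasurable).enorm)
  have hGx : G x = ‖f x - P x‖ₑ := indicator_of_mem (mem_inter (mem_ball_self ht) hx) _
  have hGint : ∫⁻ y, G y = ∫⁻ y in ball x t ∩ Ω, ‖f y - P y‖ₑ := lintegral_indicator hmeas _
  have hGk (k : ℕ) : AEMeasurable (fun h => G (x + (k : ℝ) • h)) := by
    rcases eq_or_ne k 0 with rfl | hk
    · simp
    · exact (hGm.comp_quasiMeasurePreserving
        (measurePreserving_add_left volume x).quasiMeasurePreserving).comp_quasiMeasurePreserving
        (Measure.quasiMeasurePreserving_smul volume (Nat.cast_ne_zero.2 hk))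
  have hmem : ∀ h ∈ V, ∀ k ≤ N, x + (k : ℝ) • h ∈ ball x t ∩ Ω := by
    intro h hh k hk
    refine ⟨?_, hh.2 k hk⟩
    rw [mem_ball_iff_norm, add_sub_cancel_left, norm_smul, Real.norm_natCast]
    calc (k : ℝ) * ‖h‖ ≤ N * ‖h‖ := by gcongr
      _ < N * (t / N) := by gcongr; exact hh.1
      _ = t := by field_simp
  have hpoint : ∀ h ∈ V, ‖deltaN d N f h x‖ₑ ≤
      ∑ k ∈ Finset.range (N + 1), (N.choose k : ℝ≥0∞) * G (x + (k : ℝ) • h) := by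
    intro h hh
    rw [← sub_zero (deltaN d N f h x), ← deltaN_eq_zero_of_mem_polyFuns hP h x, ← deltaN_sub]
    refine (enorm_deltaN_le _ _ _ _ _).trans_eq (Finset.sum_congr rfl fun k hk => ?_)
    rw [hG, indicator_of_mem (hmem h hh k (Nat.lt_succ_iff.1 (Finset.mem_range.1 hk)))]
  have hterm (k : ℕ) :
      τ * ∫⁻ h in V, G (x + (k : ℝ) • h) ≤ (v + 1) * (G x + τ * ∫⁻ y, G y) := by
    rcases eq_or_ne k 0 with rfl | hk
    · have hVt : V ⊆ ball 0 t := fun h hh => by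
        simpa using (hmem h hh 1 hN).1
      calc τ * ∫⁻ h in V, G (x + ((0 : ℕ) : ℝ) • h) = τ * volume V * G x := by
            simp [mul_comm, mul_left_comm]
        _ ≤ τ * volume (ball (0 : Euc d) t) * G x := by gcongr
        _ = v * G x := by rw [ofReal_rpow_neg_mul_volume_ball d ht]
        _ ≤ (v + 1) * (G x + τ * ∫⁻ y, G y) := by gcongr <;> exact le_self_add
    · calc τ * ∫⁻ h in V, G (x + (k : ℝ) • h) ≤ τ * ∫⁻ h, G (x + (k : ℝ) • h) := by
            gcongr
            exact Measure.restrict_le_self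
        _ ≤ 1 * (τ * ∫⁻ y, G y) := by
            rw [one_mul]
            gcongr 1
            exact lintegral_add_natCast_smul_le hk x hGm
        _ ≤ (v + 1) * (G x + τ * ∫⁻ y, G y) := by gcongr <;> exact le_add_self
  have hc : ENNReal.ofReal (2 ^ N * (v.toReal + 1)) = 2 ^ N * (v + 1) := by
    rw [ENNReal.ofReal_mul (by positivity), ENNReal.ofReal_add (by positivity) zero_le_one,
      ENNReal.ofReal_toReal hvtop, ENNReal.ofReal_pow zero_le_two]
    simp
  rw [hc, ← hGx, ← hGint]
  calc τ * ∫⁻ h in V, ‖deltaN d N f h x‖ₑ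
      ≤ τ * ∫⁻ h in V,
          ∑ k ∈ Finset.range (N + 1), (N.choose k : ℝ≥0∞) * G (x + (k : ℝ) • h) := by
        gcongr 1
        exact setLIntegral_mono_ae
          (Finset.aemeasurable_fun_sum _ fun k _ => ((hGk k).const_mul _).restrict)
          (ae_of_all _ hpoint)
    _ = ∑ k ∈ Finset.range (N + 1),
          (N.choose k : ℝ≥0∞) * (τ * ∫⁻ h in V, G (x + (k : ℝ) • h)) := by
        rw [lintegral_finsetSum' _ fun k _ => ((hGk k).const_mul _).restrict, Finset.mul_sum]
        refine Finset.sum_congr rfl fun k _ => ?_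
        rw [lintegral_const_mul'' _ (hGk k).restrict, mul_left_comm]
    _ ≤ ∑ k ∈ Finset.range (N + 1),
          (N.choose k : ℝ≥0∞) * ((v + 1) * (G x + τ * ∫⁻ y, G y)) := by
        exact Finset.sum_le_sum fun k _ => mul_le_mul_right (hterm k) _
    _ = 2 ^ N * (v + 1) * (G x + τ * ∫⁻ y, G y) := by
        rw [← Finset.sum_mul, mul_assoc]
        congr 1
        exact_mod_cast congr_arg (Nat.cast (R := ℝ≥0∞)) (Nat.sum_range_choose N)
end
end

section
/- Let d, N ∈ ℕ, let Ω ⊆ ℝ^d be a nonempty open set, let C > 0 and T₀ > 0, and let I be a finite index set. Suppose that for every x ∈ Ω and every 0 < t ≤ T₀ we are given a family (p_{i,x,t})_{i ∈ I} of polynomials in 𝒫_{N−1} that is orthonormal with respect to the inner product ⟨f,g⟩_{x,t} := t^{−d} ∫_{B(x,t) ∩ Ω} f(z) · conj(g(z)) dz, whose linear span contains the restriction to B(x,t) ∩ Ω of every polynomial in 𝒫_{N−1}, and which satisfies sup_{y ∈ B(x,t) ∩ Ω} |p_{i,x,t}(y)| ≤ C for all i ∈ I. Set (Π_{x,t} f)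 := Σ_{i ∈ I} ⟨f, p_{i,x,t}⟩_{x,t} · p_{i,x,t}. Then there is a constant c > 0, depending only on C, |I| and d, such that for every locally integrable f : Ω → ℂ and almost every x ∈ Ω: for all 0 < t ≤ T₀, |f(x) − (Π_{x,t} f)(x)| ≤ c · Σ_{ℓ=0}^∞ osc_{1,Ω}^{N−1} f(x, 2^{−ℓ} t). -/
open MeasureTheory ENNReal Set Metric Filter
open scoped NNReal Topology

noncomputable section

lemma const_mem_polyFuns {d N : ℕ} (hN : 0 < N) (a : ℂ) : (fun _ => a) ∈ polyFuns d N :=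
  ⟨MvPolynomial.C a, by simpa using hN, fun x => by simp⟩

/-- Almost every point of an open set is a Lebesgue point of a locally integrable function. -/
lemma MemLvLoc.ae_tendsto_lintegral_enorm_sub {d : ℕ} {Ω : Set (Euc d)} (hΩ : IsOpen Ω)
    {f : Euc d → ℂ} (hf : MemLvLoc d 1 Ω f) :
    ∀ᵐ x ∂volume.restrict Ω, Tendsto (fun s : ℝ => ENNReal.ofReal (s ^ (-(d : ℝ))) *
      ∫⁻ y in ball x s ∩ Ω, ‖f y - f x‖ₑ) (𝓝[>] 0) (𝓝 0) := by
  rw [ae_restrict_iff' hΩ.measurableSet]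
  refine measure_null_of_locally_null _ fun z hz => ?_
  have hzΩ : z ∈ Ω := by
    by_contra h
    exact hz fun h' => absurd h' h
  obtain ⟨r, hr, hrΩ⟩ := nhds_basis_closedBall.mem_iff.1 (hΩ.mem_nhds hzΩ)
  have hfB : IntegrableOn f (closedBall z r) := by
    refine ⟨(hf.1.mono_measure (Measure.restrict_mono hrΩ le_rfl)).aestronglyMeasurable, ?_⟩
    simpa [HasFiniteIntegral, enorm] using hf.2 _ (isCompact_closedBall z r) hrΩ
  have hg := hfB.integrable_indicator measurableSet_closedBall
  have key := (Besicovitch.vitaliFamily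
    (volume : Measure (Euc d))).ae_tendsto_lintegral_enorm_sub_div_of_integrable hg
  refine ⟨_, inter_mem_nhdsWithin _ (ball_mem_nhds z hr), measure_mono_null ?_ key⟩
  rintro x ⟨hx, hxr⟩ hlim
  refine hx fun _ => ?_
  have h1 := hlim.comp (Besicovitch.tendsto_filterAt volume x)
  have h2 := ENNReal.Tendsto.const_mul (a := volume (ball (0 : Euc d) 1)) h1
    (Or.inr measure_ball_lt_top.ne)
  rw [mul_zero] at h2
  refine tendsto_of_tendsto_of_tendsto_of_le_of_le' tendsto_const_nhds h2
    (Eventually.of_forall fun _ => zero_le) ?_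
  have hsub : ∀ᶠ s in 𝓝[>] (0 : ℝ), closedBall x s ⊆ closedBall z r := by
    obtain ⟨ε, hε, hεr⟩ := nhds_basis_closedBall.mem_iff.1 (isOpen_ball.mem_nhds hxr)
    filter_upwards [Ioc_mem_nhdsGT hε] with s hs
    exact (closedBall_subset_closedBall hs.2).trans (hεr.trans ball_subset_closedBall)
  filter_upwards [hsub, self_mem_nhdsWithin] with s hs (hs0 : 0 < s)
  have hint : ∫⁻ y in ball x s ∩ Ω, ‖f y - f x‖ₑ ≤ ∫⁻ y in closedBall x s,
      ‖(closedBall z r).indicator f y - (closedBall z r).indicator f x‖ₑ := by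
    refine (lintegral_mono_set (inter_subset_left.trans ball_subset_closedBall)).trans_eq ?_
    refine setLIntegral_congr_fun measurableSet_closedBall fun y hy => ?_
    simp only [indicator_of_mem (hs hy), indicator_of_mem (ball_subset_closedBall hxr)]
  have hs_pow : ENNReal.ofReal (s ^ (-(d : ℝ))) = (ENNReal.ofReal (s ^ d))⁻¹ := by
    rw [Real.rpow_neg hs0.le, Real.rpow_natCast, ENNReal.ofReal_inv_of_pos (by positivity)]
  have hvol : volume (closedBall x s) = ENNReal.ofReal (s ^ d) * volume (ball (0 : Euc d) 1) := by
    simpa using Measure.addHaar_closedBall (volume : Measure (Euc d)) x hs0.le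
  have hb0 : volume (ball (0 : Euc d) 1) ≠ 0 := (measure_ball_pos _ _ one_pos).ne'
  have hbt : volume (ball (0 : Euc d) 1) ≠ ⊤ := measure_ball_lt_top.ne
  refine (mul_le_mul_right hint _).trans_eq ?_
  simp only [Function.comp_apply]
  rw [hvol, hs_pow, ENNReal.div_eq_inv_mul, ENNReal.mul_inv (Or.inr hbt) (Or.inr hb0), ← mul_assoc,
    mul_comm (_)⁻¹ (_)⁻¹, ← mul_assoc, ENNReal.mul_inv_cancel hb0 hbt, one_mul]

open scoped Classical in
/-- Projecting onto a uniformly bounded orthonormal system changes the value at a point by at most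
the mean distance to any function in its span. -/
lemma enorm_sum_innerXT_mul_sub_le {d : ℕ} {C : ℝ} {ι : Type} [Fintype ι]
    {Ω : Set (Euc d)} (hΩ : IsOpen Ω) {x : Euc d} (hx : x ∈ Ω) {s : ℝ} (hs : 0 < s)
    {q : ι → Euc d → ℂ} (hqc : ∀ i, Continuous (q i))
    (hq : ∀ i j, innerXT d Ω x s (q i) (q j) = if i = j then 1 else 0)
    (hqC : ∀ i, ∀ y ∈ ball x s ∩ Ω, ‖q i y‖ ≤ C)
    {f P : Euc d → ℂ} (hf : AEMeasurable f (volume.restrict Ω)) (hP : Continuous P)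
    {a : ι → ℂ} (ha : ∀ z ∈ ball x s ∩ Ω, P z = ∑ i, a i * q i z) :
    ‖∑ i, innerXT d Ω x s f (q i) * q i x - P x‖ₑ ≤
      ENNReal.ofReal (Fintype.card ι * C ^ 2 + 1) *
        (ENNReal.ofReal (s ^ (-(d : ℝ))) * ∫⁻ y in ball x s ∩ Ω, ‖f y - P y‖ₑ) := by
  set S := ball x s ∩ Ω with hS
  have hSm : MeasurableSet S := measurableSet_ball.inter hΩ.measurableSet
  have hxS : x ∈ S := ⟨mem_ball_self hs, hx⟩
  have hsd : 0 < s ^ (-(d : ℝ)) := Real.rpow_pos_of_pos hs _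
  have hK : (0 : ℝ) < Fintype.card ι * C ^ 2 + 1 := by positivity
  have hcont : ∀ {g : Euc d → ℂ}, Continuous g → IntegrableOn g S := fun hg =>
    (hg.continuousOn.integrableOn_compact (isCompact_closedBall x s)).mono_set
      (inter_subset_left.trans ball_subset_closedBall)
  by_cases htop : ∫⁻ y in S, ‖f y - P y‖ₑ = ⊤
  · rw [htop, ENNReal.mul_top (ENNReal.ofReal_pos.2 hsd).ne',
      ENNReal.mul_top (ENNReal.ofReal_pos.2 hK).ne']
    exact le_top
  have hfm : AEMeasurable f (volume.restrict S) :=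
    hf.mono_measure (Measure.restrict_mono inter_subset_right le_rfl)
  have hfP : IntegrableOn (fun y => f y - P y) S :=
    ⟨(hfm.sub hP.aemeasurable).aestronglyMeasurable, lt_top_iff_ne_top.2 htop⟩
  have hbdd : ∀ {g : Euc d → ℂ}, IntegrableOn g S → ∀ i,
      IntegrableOn (fun z => g z * (starRingEnd ℂ) (q i z)) S := by
    intro g hg i
    refine Integrable.mul_bdd (c := C) hg
      (Complex.continuous_conj.comp (hqc i)).aestronglyMeasurable ?_
    filter_upwards [ae_restrict_mem hSm] with y hy
    simpa using hqC i y hy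
  have hinnerP : ∀ j, innerXT d Ω x s P (q j) = a j := by
    intro j
    have h1 : ∫ z in S, P z * (starRingEnd ℂ) (q j z) =
        ∑ i, a i * ∫ z in S, q i z * (starRingEnd ℂ) (q j z) := by
      rw [setIntegral_congr_fun (g := fun z => ∑ i, a i * (q i z * (starRingEnd ℂ) (q j z))) hSm
        fun z hz => by simp only [ha z hz, Finset.sum_mul, mul_assoc]]
      rw [integral_finsetSum _ fun i _ => (hbdd (hcont (hqc i)) j).const_mul _]
      simp only [integral_const_mul]
    calc innerXT d Ω x s P (q j) = ∑ i, a i * innerXT d Ω x s (q i) (q j) := by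
          simp only [innerXT, ← hS, h1, Finset.mul_sum]
          exact Finset.sum_congr rfl fun i _ => by ring
      _ = a j := by simp [hq]
  have hinner : ∀ i, innerXT d Ω x s f (q i) - a i =
      innerXT d Ω x s (fun y => f y - P y) (q i) := by
    intro i
    have h1 := integral_add (hbdd hfP i) (hbdd (hcont hP) i)
    have h2 : ∀ z, f z * (starRingEnd ℂ) (q i z) = (f z - P z) * (starRingEnd ℂ) (q i z)
      + P z * (starRingEnd ℂ) (q i z) := fun z => by ring
    rw [← hinnerP i]
    simp only [innerXT, ← hS, h2, h1]
    ring
  have hnorm : ∀ i, ‖innerXT d Ω x s (fun y => f y - P y) (q i)‖ ≤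
      s ^ (-(d : ℝ)) * ((∫ y in S, ‖f y - P y‖) * C) := by
    intro i
    rw [innerXT, norm_mul, Complex.norm_real, Real.norm_of_nonneg hsd.le, ← integral_mul_const]
    gcongr
    refine norm_integral_le_of_norm_le (hfP.norm.mul_const C) ?_
    filter_upwards [ae_restrict_mem hSm] with y hy
    rw [norm_mul, RCLike.norm_conj]
    gcongr
    exact hqC i y hy
  have hmain : ‖∑ i, innerXT d Ω x s f (q i) * q i x - P x‖ ≤
      (Fintype.card ι * C ^ 2 + 1) * (s ^ (-(d : ℝ)) * ∫ y in S, ‖f y - P y‖) := by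
    have hI : 0 ≤ ∫ y in S, ‖f y - P y‖ := integral_nonneg fun _ => norm_nonneg _
    calc ‖∑ i, innerXT d Ω x s f (q i) * q i x - P x‖
        = ‖∑ i, innerXT d Ω x s (fun y => f y - P y) (q i) * q i x‖ := by
          rw [ha x hxS, ← Finset.sum_sub_distrib]
          simp only [← sub_mul, hinner]
      _ ≤ ∑ _i : ι, s ^ (-(d : ℝ)) * ((∫ y in S, ‖f y - P y‖) * C) * C := by
          refine norm_sum_le_of_le _ fun i _ => ?_
          rw [norm_mul]
          exact mul_le_mul (hnorm i) (hqC i x hxS) (norm_nonneg _)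
            ((norm_nonneg _).trans (hnorm i))
      _ = Fintype.card ι * C ^ 2 * (s ^ (-(d : ℝ)) * ∫ y in S, ‖f y - P y‖) := by
          rw [Finset.sum_const, Finset.card_univ, nsmul_eq_mul]
          ring
      _ ≤ _ := by gcongr; linarith
  rw [← ofReal_norm]
  refine (ENNReal.ofReal_le_ofReal hmain).trans_eq ?_
  rw [ENNReal.ofReal_mul hK.le, ENNReal.ofReal_mul hsd.le,
    ofReal_integral_norm_eq_lintegral_enorm hfP]

lemma osc_one {d N : ℕ} {Ω : Set (Euc d)} {f : Euc d → ℂ} {x : Euc d} {t : ℝ} :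
    osc d N 1 Ω f x t = ⨅ (P : Euc d → ℂ) (_ : P ∈ polyFuns d N),
      ENNReal.ofReal (t ^ (-(d : ℝ))) * ∫⁻ y in ball x t ∩ Ω, ‖f y - P y‖ₑ := by
  simp [osc, enorm]

open scoped Classical in
/-- Pointwise control of `|f(x) − (Π_{x,t} f)(x)|` by the dyadic sum of local
oscillations, with a constant depending only on `C`, `|I|` and `d`. -/
theorem statement15 (d : ℕ) (hd : 0 < d) (C : ℝ) (hC : 0 < C)
    {ι : Type} [Fintype ι] :
    ∃ c : ℝ, 0 < c ∧
      ∀ (N : ℕ), 0 < N →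
      ∀ (Ω : Set (Euc d)), IsOpen Ω → Ω.Nonempty →
      ∀ T₀ : ℝ, 0 < T₀ →
      ∀ p : Euc d → ℝ → ι → Euc d → ℂ,
        (∀ x ∈ Ω, ∀ t : ℝ, 0 < t → t ≤ T₀ → ∀ i, p x t i ∈ polyFuns d N) →
        (∀ x ∈ Ω, ∀ t : ℝ, 0 < t → t ≤ T₀ → ∀ i j,
          innerXT d Ω x t (p x t i) (p x t j) = if i = j then 1 else 0) →
        (∀ x ∈ Ω, ∀ t : ℝ, 0 < t → t ≤ T₀ → ∀ Q ∈ polyFuns d N,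
          ∃ a : ι → ℂ, ∀ z ∈ Metric.ball x t ∩ Ω, Q z = ∑ i, a i * p x t i z) →
        (∀ x ∈ Ω, ∀ t : ℝ, 0 < t → t ≤ T₀ → ∀ i,
          ∀ y ∈ Metric.ball x t ∩ Ω, ‖p x t i y‖ ≤ C) →
      ∀ f : Euc d → ℂ, MemLvLoc d 1 Ω f →
        ∀ᵐ x ∂volume.restrict Ω, ∀ t : ℝ, 0 < t → t ≤ T₀ →
          ((‖f x - ∑ i, innerXT d Ω x t f (p x t i) * p x t i x‖₊ : ℝ≥0∞))
            ≤ ENNReal.ofReal c *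
                ∑' ℓ : ℕ, osc d N 1 Ω f x ((2 : ℝ) ^ (-(ℓ : ℝ)) * t) := by
  classical
  set K : ℝ := Fintype.card ι * C ^ 2 + 1 with hKdef
  have hK : 0 < K := by positivity
  have hc : 0 < K * (1 + 2 ^ d) := by positivity
  refine ⟨K * (1 + 2 ^ d), hc, ?_⟩
  intro N hN Ω hΩ _ T₀ _ p hpoly horth hspan hbound f hf
  filter_upwards [hf.ae_tendsto_lintegral_enorm_sub hΩ, ae_restrict_mem hΩ.measurableSet]
    with x hleb hx t ht htT
  set A : ℝ → ℂ := fun s => ∑ i, innerXT d Ω x s f (p x s i) * p x s i x with hA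
  have key : ∀ s, 0 < s → s ≤ T₀ → ∀ P ∈ polyFuns d N, ‖A s - P x‖ₑ ≤ ENNReal.ofReal K *
      (ENNReal.ofReal (s ^ (-(d : ℝ))) * ∫⁻ y in ball x s ∩ Ω, ‖f y - P y‖ₑ) := by
    intro s hs hsT P hP
    obtain ⟨a, ha⟩ := hspan x hx s hs hsT P hP
    exact enorm_sum_innerXT_mul_sub_le hΩ hx hs
      (fun i => continuous_of_mem_polyFuns (hpoly x hx s hs hsT i)) (horth x hx s hs hsT)
      (hbound x hx s hs hsT) hf.1 (continuous_of_mem_polyFuns hP) ha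
  have hstep : ∀ s, 0 < s → s ≤ T₀ → edist (A s) (A (s / 2)) ≤
      ENNReal.ofReal (K * (1 + 2 ^ d)) * osc d N 1 Ω f x s := by
    intro s hs hsT
    have h0 : ENNReal.ofReal (K * (1 + 2 ^ d)) ≠ 0 := (ENNReal.ofReal_pos.2 hc).ne'
    simp only [osc_one, ENNReal.mul_iInf_of_ne h0 ENNReal.ofReal_ne_top]
    refine le_iInf₂ fun P hP => ?_
    have hhalf : ENNReal.ofReal ((s / 2) ^ (-(d : ℝ))) =
        ENNReal.ofReal (2 ^ d) * ENNReal.ofReal (s ^ (-(d : ℝ))) := by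
      rw [← ENNReal.ofReal_mul (by positivity), Real.div_rpow hs.le zero_le_two,
        Real.rpow_neg zero_le_two, Real.rpow_natCast, div_inv_eq_mul, mul_comm]
    have h2 := key (s / 2) (half_pos hs) ((half_le_self hs.le).trans hsT) P hP
    rw [hhalf] at h2
    have hmono : ∫⁻ y in ball x (s / 2) ∩ Ω, ‖f y - P y‖ₑ ≤ ∫⁻ y in ball x s ∩ Ω, ‖f y - P y‖ₑ :=
      lintegral_mono_set (inter_subset_inter_left _ (ball_subset_ball (half_le_self hs.le)))
    calc edist (A s) (A (s / 2)) ≤ edist (A s) (P x) + edist (A (s / 2)) (P x) :=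
          edist_triangle_right _ _ _
      _ = ‖A s - P x‖ₑ + ‖A (s / 2) - P x‖ₑ := by simp only [edist_eq_enorm_sub]
      _ ≤ _ := add_le_add (key s hs hsT P hP)
          (h2.trans (mul_le_mul_right (mul_le_mul_right hmono _) _))
      _ = _ := by
          rw [ENNReal.ofReal_mul hK.le, ENNReal.ofReal_add zero_le_one (by positivity),
            ENNReal.ofReal_one]
          ring
  have hlim0 : Tendsto A (𝓝[>] 0) (𝓝 (f x)) := by
    rw [tendsto_iff_edist_tendsto_0]
    have h := ENNReal.Tendsto.const_mul (a := ENNReal.ofReal K) hleb (Or.inr ENNReal.ofReal_ne_top)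
    rw [mul_zero] at h
    refine tendsto_of_tendsto_of_tendsto_of_le_of_le' tendsto_const_nhds h
      (Eventually.of_forall fun _ => zero_le) ?_
    filter_upwards [Ioc_mem_nhdsGT (ht.trans_le htT)] with s hs
    rw [edist_eq_enorm_sub]
    exact key s hs.1 hs.2 _ (const_mem_polyFuns hN (f x))
  have hpow : ∀ n : ℕ, (2 : ℝ) ^ (-(n : ℝ)) = (1 / 2) ^ n := fun n => by
    rw [Real.rpow_neg zero_le_two, Real.rpow_natCast, one_div, inv_pow]
  have hpos : ∀ n : ℕ, 0 < (2 : ℝ) ^ (-(n : ℝ)) * t := fun n => by positivity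
  have hlim : Tendsto (fun n : ℕ => A ((2 : ℝ) ^ (-(n : ℝ)) * t)) atTop (𝓝 (f x)) := by
    refine hlim0.comp (tendsto_nhdsWithin_iff.2 ⟨?_, Eventually.of_forall hpos⟩)
    simp only [hpow]
    simpa using (tendsto_pow_atTop_nhds_zero_of_lt_one (r := (1 / 2 : ℝ)) (by norm_num)
      (by norm_num)).mul_const t
  have hsum := edist_le_tsum_of_edist_le_of_tendsto₀
    (fun n : ℕ => ENNReal.ofReal (K * (1 + 2 ^ d)) * osc d N 1 Ω f x ((2 : ℝ) ^ (-(n : ℝ)) * t))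
    (fun n => by
      have hle : (2 : ℝ) ^ (-(n : ℝ)) * t ≤ t := by
        rw [hpow]
        exact mul_le_of_le_one_left ht.le (pow_le_one₀ (by norm_num) (by norm_num))
      have hhalf : (2 : ℝ) ^ (-((n.succ : ℕ) : ℝ)) * t = (2 : ℝ) ^ (-(n : ℝ)) * t / 2 := by
        rw [hpow, hpow, pow_succ]
        ring
      rw [hhalf]
      exact hstep _ (hpos n) (hle.trans htT)) hlim
  rw [ENNReal.tsum_mul_left, edist_comm, edist_eq_enorm_sub] at hsum
  simpa [hA, enorm] using hsum
end
end

section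
/- Let d, N, L ∈ ℕ, set Ñ := N + L − 1, let Ω ⊆ ℝ^d be a nonempty open set, and let σ ∈ C_c^∞(ℝ^d) be a smooth compactly supported function. Then there exists a constant c > 0, depending only on σ, d, N, L, such that for every locally integrable f : Ω → ℂ, every x ∈ Ω and every 0 < t ≤ 1: osc_{1,Ω}^{Ñ−1} (σ|_Ω · f)(x,t) ≤ c · ( osc_{1,Ω}^{N−1} f(x,t) + t^{L−d} ∫_{B(x,t) ∩ Ω} |f(y)| dy ). -/
open MeasureTheory ENNReal Set Metric Filter
open scoped NNReal Topology

noncomputable section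

open scoped Nat in
/-- The diagonal of a multilinear map, translated to the base point `x`, is a polynomial. -/
lemma exists_mvPolynomial_multilinear_diag {d k : ℕ}
    (A : ContinuousMultilinearMap ℝ (fun _ : Fin k => Euc d) ℂ) (x : Euc d) :
    ∃ Q : MvPolynomial (Fin d) ℂ, Q.totalDegree ≤ k ∧
      ∀ y : Euc d, A (fun _ => y - x) =
        MvPolynomial.eval (fun i => ((y i : ℝ) : ℂ)) Q := by
  refine ⟨∑ r : Fin k → Fin d,
    MvPolynomial.C (A fun i => EuclideanSpace.single (r i) (1 : ℝ)) *
      ∏ i, (MvPolynomial.X (r i) - MvPolynomial.C ((x (r i) : ℝ) : ℂ)), ?_, ?_⟩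
  · refine MvPolynomial.totalDegree_finsetSum_le fun r _ => ?_
    refine (MvPolynomial.totalDegree_mul _ _).trans ?_
    rw [MvPolynomial.totalDegree_C, zero_add]
    refine (MvPolynomial.totalDegree_finsetProd _ _).trans ?_
    calc _ ≤ ∑ _i : Fin k, 1 := Finset.sum_le_sum fun i _ =>
          (MvPolynomial.totalDegree_sub_C_le _ _).trans (MvPolynomial.totalDegree_X _).le
      _ = k := by simp
  · intro y
    have hy : (y - x : Euc d) =
        ∑ j : Fin d, (y j - x j) • EuclideanSpace.single j (1 : ℝ) := by
      ext i
      simp [Finset.sum_apply, Pi.single_apply]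
    conv_lhs => rw [hy]
    rw [A.map_sum]
    simp only [A.map_smul_univ, map_sum, map_mul, map_prod, map_sub, MvPolynomial.eval_C,
      MvPolynomial.eval_X, Complex.real_smul, Complex.ofReal_prod, Complex.ofReal_sub]
    exact Finset.sum_congr rfl fun r _ => mul_comm _ _

open scoped Nat in
/-- A smooth compactly supported function is approximated on unit balls by polynomials of degree
at most `n`, uniformly in the centre and with error of order `n + 1` in the radius. -/
lemma exists_polyFuns_approx {d : ℕ} (n : ℕ) {σ : Euc d → ℂ}
    (hσ : ContDiff ℝ (⊤ : ℕ∞) σ) (hsupp : HasCompactSupport σ) :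
    ∃ c : ℝ, 0 < c ∧ ∀ x : Euc d, ∃ Q : MvPolynomial (Fin d) ℂ, Q.totalDegree ≤ n ∧
      ∀ t : ℝ, t ≤ 1 → ∀ y ∈ ball x t,
        ‖MvPolynomial.eval (fun i => ((y i : ℝ) : ℂ)) Q‖ ≤ c ∧
        ‖σ y - MvPolynomial.eval (fun i => ((y i : ℝ) : ℂ)) Q‖ ≤ c * t ^ (n + 1) := by
  have hb : ∀ k : ℕ, ∃ C, ∀ x, ‖iteratedFDeriv ℝ k σ x‖ ≤ C := fun k =>
    (hσ.continuous_iteratedFDeriv (by exact_mod_cast le_top)).bounded_above_of_compact_support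
      (hsupp.iteratedFDeriv k)
  choose M hM using hb
  have hM0 : ∀ k, 0 ≤ M k := fun k => (norm_nonneg _).trans (hM k 0)
  have hS0 : 0 ≤ ∑ k ∈ Finset.range (n + 1), M k := Finset.sum_nonneg fun k _ => hM0 k
  refine ⟨∑ k ∈ Finset.range (n + 1), M k + M (n + 1) + 1, by linarith [hM0 (n + 1)], fun x => ?_⟩
  choose Q hQd hQ using fun k : ℕ =>
    exists_mvPolynomial_multilinear_diag (iteratedFDeriv ℝ k σ x) x
  have hfac : ∀ k : ℕ, ((k ! : ℝ))⁻¹ ≤ 1 := fun k =>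
    inv_le_one_of_one_le₀ (by exact_mod_cast Nat.factorial_pos k)
  refine ⟨∑ k ∈ Finset.range (n + 1), MvPolynomial.C (((k ! : ℝ)⁻¹ : ℝ) : ℂ) * Q k, ?_, ?_⟩
  · refine MvPolynomial.totalDegree_finsetSum_le fun k hk => ?_
    refine (MvPolynomial.totalDegree_mul _ _).trans ?_
    rw [MvPolynomial.totalDegree_C, zero_add]
    exact (hQd k).trans (Nat.lt_succ_iff.mp (Finset.mem_range.mp hk))
  intro t ht y hy
  have hyx : ‖y - x‖ < t := by rwa [mem_ball, dist_eq_norm] at hy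
  have ht0 : 0 < t := (norm_nonneg _).trans_lt hyx
  have hev : MvPolynomial.eval (fun i => ((y i : ℝ) : ℂ))
      (∑ k ∈ Finset.range (n + 1), MvPolynomial.C (((k ! : ℝ)⁻¹ : ℝ) : ℂ) * Q k) =
      ∑ k ∈ Finset.range (n + 1),
        (k ! : ℝ)⁻¹ • iteratedFDeriv ℝ k σ x (fun _ => y - x) := by
    simp only [map_sum, map_mul, MvPolynomial.eval_C, ← hQ, Complex.real_smul]
  have hop : ∀ (k : ℕ) (z : Euc d),
      ‖iteratedFDeriv ℝ k σ z (fun _ => y - x)‖ ≤ M k * t ^ k := fun k z => by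
    refine ((iteratedFDeriv ℝ k σ z).le_opNorm _).trans ?_
    rw [Finset.prod_const, Finset.card_univ, Fintype.card_fin]
    gcongr
    exacts [hM0 k, hM k z]
  rw [hev]
  constructor
  · refine (norm_sum_le _ _).trans ?_
    refine (Finset.sum_le_sum (g := M) fun k _ => ?_).trans (by linarith [hM0 (n + 1)])
    rw [norm_smul, Real.norm_of_nonneg (by positivity)]
    calc _ ≤ 1 * (M k * 1) := by
          gcongr
          · exact hfac k
          · exact (hop k x).trans
              (mul_le_mul_of_nonneg_left (pow_le_one₀ ht0.le ht) (hM0 k))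
      _ = M k := by ring
  · have hT := map_add_eq_sum_add_integral_iteratedFDeriv (f := σ) (x := x) (y := y - x) (n := n)
      (fun s _ => (hσ.of_le (by exact_mod_cast le_top)).contDiffAt)
    rw [add_sub_cancel] at hT
    rw [hT, add_sub_cancel_left, norm_smul, Real.norm_of_nonneg (by positivity)]
    have hI : ‖∫ s in (0 : ℝ)..1, (1 - s) ^ n •
        iteratedFDeriv ℝ (n + 1) σ (x + s • (y - x)) (fun _ => y - x)‖ ≤
        M (n + 1) * t ^ (n + 1) * |1 - 0| := by
      refine intervalIntegral.norm_integral_le_of_norm_le_const fun s hs => ?_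
      rw [uIoc_of_le zero_le_one] at hs
      rw [norm_smul, norm_pow, Real.norm_of_nonneg (by linarith [hs.2])]
      calc _ ≤ 1 * (M (n + 1) * t ^ (n + 1)) := by
            gcongr
            · exact pow_le_one₀ (by linarith [hs.2]) (by linarith [hs.1])
            · exact hop _ _
        _ = _ := one_mul _
    calc _ ≤ 1 * (M (n + 1) * t ^ (n + 1) * |1 - 0|) := by
          gcongr
          exact hfac n
      _ = M (n + 1) * t ^ (n + 1) := by simp
      _ ≤ _ := by
          gcongr
          linarith

/-- Oscillation of a product with a smooth compactly supported cut-off: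
`osc_{1,Ω}^{Ñ−1}(σ f)(x,t) ≤ c (osc_{1,Ω}^{N−1} f(x,t) + t^{L−d} ∫_{B(x,t)∩Ω} |f|)`
for `0 < t ≤ 1`, where `Ñ = N + L − 1`. -/
theorem statement16 (d N L : ℕ) (hd : 0 < d) (hN : 0 < N) (hL : 0 < L)
    (σ : Euc d → ℂ) (hσ : ContDiff ℝ (⊤ : ℕ∞) σ) (hsupp : HasCompactSupport σ) :
    ∃ c : ℝ, 0 < c ∧
      ∀ (Ω : Set (Euc d)), IsOpen Ω → Ω.Nonempty →
      ∀ f : Euc d → ℂ, MemLvLoc d 1 Ω f →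
      ∀ x ∈ Ω, ∀ t : ℝ, 0 < t → t ≤ 1 →
        osc d (N + L - 1) 1 Ω (fun y => σ y * f y) x t
          ≤ ENNReal.ofReal c *
            (osc d N 1 Ω f x t +
              ENNReal.ofReal (t ^ ((L : ℝ) - (d : ℝ))) *
                ∫⁻ y in Metric.ball x t ∩ Ω, (‖f y‖₊ : ℝ≥0∞)) := by
  obtain ⟨n, rfl⟩ : ∃ n, L = n + 1 := ⟨L - 1, by omega⟩
  obtain ⟨c, hc, happ⟩ := exists_polyFuns_approx n hσ hsupp
  refine ⟨c, hc, fun Ω hΩ _ f hf x _ t ht ht1 => ?_⟩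
  obtain ⟨Q, hQd, hQ⟩ := happ x
  have hfm : AEMeasurable f (volume.restrict (ball x t ∩ Ω)) :=
    hf.1.mono_measure (Measure.restrict_mono inter_subset_right le_rfl)
  conv_rhs => rw [osc]
  rw [ENNReal.iInf₂_add, ENNReal.mul_iInf_of_ne (by simpa using hc) ENNReal.ofReal_ne_top]
  refine le_iInf fun P => ?_
  rw [ENNReal.mul_iInf_of_ne (by simpa using hc) ENNReal.ofReal_ne_top]
  refine le_iInf fun hP => ?_
  obtain ⟨R, hRd, hR⟩ := hP
  set T : Euc d → ℂ := fun y => MvPolynomial.eval (fun i => ((y i : ℝ) : ℂ)) Q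
  have hTP : (fun y => T y * P y) ∈ polyFuns d (N + (n + 1) - 1) := by
    refine ⟨Q * R, ?_, fun y => by rw [map_mul, ← hR y]⟩
    have := MvPolynomial.totalDegree_mul Q R
    omega
  refine (iInf₂_le _ hTP).trans ?_
  simp only [ENNReal.rpow_one, div_one]
  have hpt : ∀ y ∈ ball x t, (‖σ y * f y - T y * P y‖₊ : ℝ≥0∞) ≤
      ENNReal.ofReal c * ‖f y - P y‖₊ + ENNReal.ofReal (c * t ^ (n + 1)) * ‖f y‖₊ := by
    intro y hy
    obtain ⟨h1, h2⟩ := hQ t ht1 y hy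
    simp only [← enorm_eq_nnnorm, ← ofReal_norm]
    rw [← ENNReal.ofReal_mul hc.le, ← ENNReal.ofReal_mul (by positivity),
      ← ENNReal.ofReal_add (by positivity) (by positivity)]
    refine ENNReal.ofReal_le_ofReal ?_
    calc ‖σ y * f y - T y * P y‖ = ‖T y * (f y - P y) + (σ y - T y) * f y‖ := by ring_nf
      _ ≤ ‖T y‖ * ‖f y - P y‖ + ‖σ y - T y‖ * ‖f y‖ := by
          simpa only [norm_mul] using norm_add_le (T y * (f y - P y)) ((σ y - T y) * f y)
      _ ≤ _ := by gcongr
  have hint : (∫⁻ y in ball x t ∩ Ω, (‖σ y * f y - T y * P y‖₊ : ℝ≥0∞)) ≤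
      ENNReal.ofReal c * (∫⁻ y in ball x t ∩ Ω, (‖f y - P y‖₊ : ℝ≥0∞)) +
        ENNReal.ofReal (c * t ^ (n + 1)) * ∫⁻ y in ball x t ∩ Ω, (‖f y‖₊ : ℝ≥0∞) := by
    refine (setLIntegral_mono' (measurableSet_ball.inter hΩ.measurableSet)
      fun y hy => hpt y hy.1).trans_eq ?_
    rw [lintegral_add_right' _ (hfm.nnnorm.coe_nnreal_ennreal.const_mul _),
      lintegral_const_mul' _ _ ENNReal.ofReal_ne_top,
      lintegral_const_mul' _ _ ENNReal.ofReal_ne_top]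
  have hpow : ENNReal.ofReal (t ^ (((n + 1 : ℕ) : ℝ) - (d : ℝ))) =
      ENNReal.ofReal (t ^ (-(d : ℝ))) * ENNReal.ofReal (t ^ (n + 1)) := by
    rw [← ENNReal.ofReal_mul (by positivity), sub_eq_neg_add, Real.rpow_add ht,
      Real.rpow_natCast]
  refine (mul_le_mul_right hint _).trans_eq ?_
  rw [hpow, ENNReal.ofReal_mul hc.le]
  ring
end
end
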